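/- arXiv:1112.5512 — 7 statements merged into one kernel-verified Lean document; each statement's English description precedes it below -/
import Mathlib

section
/- The (11,5,2) biplane is unique up to renaming of points: if 𝒫' is any family of 5-element subsets of Fin 11 such that every pair of distinct points of Fin 11 is contained in exactly two members of 𝒫', then there exists a bijection e : Fin 11 ≃ ZMod 11 such that the image of 𝒫' under e (mapping each member S ∈ 𝒫' to its image e(S)) is exactly the biplane 𝒫 of translates of the quadratic residues modulo 11. -/
open Finset

/-- The nonzero quadratic residues modulo 11. -/
def Q : Finset (ZMod 11) := {1, 3, 4, 5, 9}

/-- The (11,5,2) biplane: the family of the eleven translates `Q + t` of `Q`. -/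
def biplane : Finset (Finset (ZMod 11)) :=
  (Finset.univ : Finset (ZMod 11)).image fun t => Q.image (· + t)

/-- An enumeration of `Q`. -/
def residue : Fin 5 → ZMod 11 := ![1, 3, 4, 5, 9]

/-- For `z ∉ Q`, the graph on `Fin 5` joining `i` and `j` when the block other than `Q`
through `residue i` and `residue j` contains `z`. -/
def residueGraph (z : ZMod 11) (i j : Fin 5) : Bool :=
  decide (i ≠ j ∧ ∃ t : ZMod 11, t ≠ 0 ∧ residue i ∈ Q.image (· + t) ∧
    residue j ∈ Q.image (· + t) ∧ z ∈ Q.image (· + t))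

/-- The symmetric irreflexive relation on `Fin 5` with prescribed values on the ten pairs. -/
def graphOfEdges (a b c d e f g h k l : Bool) (i j : Fin 5) : Bool :=
  ![![false, a, b, c, d], ![a, false, e, f, g], ![b, e, false, h, k],
    ![c, f, h, false, l], ![d, g, k, l, false]] i j

theorem eq_graphOfEdges {R : Fin 5 → Fin 5 → Bool} (irr : ∀ i, R i i = false)
    (symm : ∀ i j, R i j = R j i) :
    R = graphOfEdges (R 0 1) (R 0 2) (R 0 3) (R 0 4) (R 1 2) (R 1 3) (R 1 4)
      (R 2 3) (R 2 4) (R 3 4) := by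
  funext i j
  fin_cases i <;> fin_cases j <;> first | exact irr _ | rfl | exact symm _ _

theorem exists_perm_graphOfEdges : ∀ a b c d e f g h k l : Bool,
    (∀ i, #{j | graphOfEdges a b c d e f g h k l i j} = 2) →
    ∃ σ : Equiv.Perm (Fin 5), ∀ i j,
      graphOfEdges a b c d e f g h k l (σ i) (σ j) = residueGraph 0 i j := by
  decide +kernel

theorem exists_residueGraph_eq_graphOfEdges : ∀ a b c d e f g h k l : Bool,
    (∀ i, #{j | graphOfEdges a b c d e f g h k l i j} = 2) →
    #{x : Fin 5 × Fin 5 | graphOfEdges a b c d e f g h k l x.1 x.2 ∧ residueGraph 0 x.1 x.2} = 4 →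
    ∃ w, w ∉ Q ∧ ∀ i j, graphOfEdges a b c d e f g h k l i j = residueGraph w i j := by
  decide +kernel

/-- Every 2-regular graph on five vertices is a pentagon. -/
theorem exists_perm_eq_residueGraph_zero {R : Fin 5 → Fin 5 → Bool} (irr : ∀ i, R i i = false)
    (symm : ∀ i j, R i j = R j i) (reg : ∀ i, #{j | R i j} = 2) :
    ∃ σ : Equiv.Perm (Fin 5), ∀ i j, R (σ i) (σ j) = residueGraph 0 i j := by
  rw [eq_graphOfEdges irr symm] at reg ⊢
  exact exists_perm_graphOfEdges _ _ _ _ _ _ _ _ _ _ reg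

/-- Only five pentagons share exactly two edges with a given one. -/
theorem exists_eq_residueGraph {R : Fin 5 → Fin 5 → Bool} (irr : ∀ i, R i i = false)
    (symm : ∀ i j, R i j = R j i) (reg : ∀ i, #{j | R i j} = 2)
    (shared : #{x : Fin 5 × Fin 5 | R x.1 x.2 ∧ residueGraph 0 x.1 x.2} = 4) :
    ∃ w, w ∉ Q ∧ ∀ i j, R i j = residueGraph w i j := by
  rw [eq_graphOfEdges irr symm] at reg shared ⊢
  exact exists_residueGraph_eq_graphOfEdges _ _ _ _ _ _ _ _ _ _ reg shared

theorem exists_translate_of_residues : ∀ i j, i ≠ j → ∃ t : ZMod 11,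
    residue i ∈ Q.image (· + t) ∧ residue j ∈ Q.image (· + t) ∧
    ∀ s : ZMod 11, s ≠ 0 → residue i ∈ Q.image (· + s) → residue j ∈ Q.image (· + s) →
      s = t := by
  decide +kernel

section Design

variable {𝒟 : Finset (Finset (Fin 11))}

theorem card_blocks_through (hcard : ∀ S ∈ 𝒟, #S = 5)
    (hpairs : ∀ x y : Fin 11, x ≠ y → #{S ∈ 𝒟 | x ∈ S ∧ y ∈ S} = 2) (x : Fin 11) :
    #{S ∈ 𝒟 | x ∈ S} = 5 := by
  have h1 : ∑ y ∈ univ.erase x, #{S ∈ 𝒟 | x ∈ S ∧ y ∈ S} = 20 := by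
    rw [sum_congr rfl fun y hy => hpairs x y (ne_of_mem_erase hy).symm]
    simp
  have h2 : ∑ y ∈ univ.erase x, #{S ∈ 𝒟 | x ∈ S ∧ y ∈ S} =
      ∑ S ∈ 𝒟 with x ∈ S, #(S.erase x) := by
    simp_rw [← filter_filter]
    refine (sum_card_bipartiteAbove_eq_sum_card_bipartiteBelow
      (fun (S : Finset (Fin 11)) y => y ∈ S)).symm.trans ?_
    refine sum_congr rfl fun S _ => congrArg card ?_
    ext y
    simp [bipartiteAbove]
  have h3 : ∑ S ∈ 𝒟 with x ∈ S, #(S.erase x) = #{S ∈ 𝒟 | x ∈ S} * 4 := by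
    refine sum_const_nat (fun S hS => ?_)
    rw [mem_filter] at hS
    rw [card_erase_of_mem hS.2, hcard S hS.1]
  omega

theorem card_blocks (hcard : ∀ S ∈ 𝒟, #S = 5)
    (hpairs : ∀ x y : Fin 11, x ≠ y → #{S ∈ 𝒟 | x ∈ S ∧ y ∈ S} = 2) : #𝒟 = 11 := by
  have h := sum_card_bipartiteAbove_eq_sum_card_bipartiteBelow (s := 𝒟)
    (t := (univ : Finset (Fin 11))) (fun S y => y ∈ S)
  simp only [bipartiteAbove, bipartiteBelow, card_blocks_through hcard hpairs,
    filter_univ_mem] at h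
  rw [sum_congr rfl hcard] at h
  simp at h
  omega

theorem card_inter_of_ne (hcard : ∀ S ∈ 𝒟, #S = 5)
    (hpairs : ∀ x y : Fin 11, x ≠ y → #{S ∈ 𝒟 | x ∈ S ∧ y ∈ S} = 2)
    {B S : Finset (Fin 11)} (hB : B ∈ 𝒟) (hS : S ∈ 𝒟) (hSB : S ≠ B) : #(S ∩ B) = 2 := by
  have h1 : ∑ S ∈ 𝒟, #(S ∩ B) = 25 := by
    have h := sum_card_bipartiteAbove_eq_sum_card_bipartiteBelow (s := 𝒟) (t := B)
      (fun S y => y ∈ S)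
    simp only [bipartiteAbove, bipartiteBelow, card_blocks_through hcard hpairs, filter_mem_eq_inter,
      sum_const, hcard B hB] at h
    simpa [inter_comm] using h
  have h2 : ∑ S ∈ 𝒟, #(S ∩ B).offDiag = 40 := by
    have h := sum_card_bipartiteAbove_eq_sum_card_bipartiteBelow (s := 𝒟) (t := B.offDiag)
      (fun S x => x.1 ∈ S ∧ x.2 ∈ S)
    have h' : ∑ x ∈ B.offDiag, #(bipartiteBelow (fun S x => x.1 ∈ S ∧ x.2 ∈ S) 𝒟 x) = 40 := by
      refine (sum_const_nat fun x hx => hpairs x.1 x.2 (mem_offDiag.1 hx).2.2).trans ?_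
      rw [offDiag_card, hcard B hB]
    rw [← h', ← h]
    refine sum_congr rfl fun S _ => congrArg card ?_
    ext x
    simp only [bipartiteAbove, mem_filter, mem_offDiag, mem_inter]
    tauto
  have h3 : ∑ S ∈ 𝒟, ((#(S ∩ B) : ℤ) - 2) ^ 2 = 9 := by
    have h4 : ∀ S ∈ 𝒟, ((#(S ∩ B) : ℤ) - 2) ^ 2 =
        (#(S ∩ B).offDiag : ℤ) - 3 * (#(S ∩ B) : ℤ) + 4 := by
      intro S _
      rw [offDiag_card, Nat.cast_sub (Nat.le_mul_self _)]
      push_cast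
      ring
    rw [sum_congr rfl h4, sum_add_distrib, sum_sub_distrib, ← mul_sum, ← Nat.cast_sum,
      ← Nat.cast_sum, h1, h2, sum_const, card_blocks hcard hpairs]
    norm_num
  rw [← add_sum_erase _ _ hB, inter_self, hcard B hB] at h3
  have h5 : ∑ S ∈ 𝒟.erase B, ((#(S ∩ B) : ℤ) - 2) ^ 2 = 0 := by
    push_cast at h3
    linarith
  have h6 := (sum_eq_zero_iff_of_nonneg fun S _ => sq_nonneg _).1 h5 S (mem_erase.2 ⟨hSB, hS⟩)
  have := pow_eq_zero_iff (two_ne_zero) |>.1 h6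
  omega

theorem eq_of_mem_of_mem
    (hpairs : ∀ x y : Fin 11, x ≠ y → #{S ∈ 𝒟 | x ∈ S ∧ y ∈ S} = 2)
    {B S T : Finset (Fin 11)} (hB : B ∈ 𝒟) (hS : S ∈ 𝒟) (hT : T ∈ 𝒟) (hSB : S ≠ B)
    (hTB : T ≠ B) {x y : Fin 11} (hxy : x ≠ y) (hxB : x ∈ B) (hyB : y ∈ B) (hxS : x ∈ S)
    (hyS : y ∈ S) (hxT : x ∈ T) (hyT : y ∈ T) : S = T := by
  by_contra hST
  have h : #{B, S, T} ≤ #{S ∈ 𝒟 | x ∈ S ∧ y ∈ S} := by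
    refine card_le_card fun U hU => ?_
    simp only [mem_insert, mem_singleton] at hU
    rw [mem_filter]
    rcases hU with rfl | rfl | rfl <;> simp [*]
  rw [hpairs x y hxy, card_eq_three.2 ⟨B, S, T, hSB.symm, hTB.symm, hST, rfl⟩] at h
  omega

/-- The graph on the points of a block `B`, enumerated by `f`, in which two points are joined
when the other block through them contains `p`. -/
def pointGraph (𝒟 : Finset (Finset (Fin 11))) (B : Finset (Fin 11)) (f : Fin 5 → Fin 11)
    (p : Fin 11) (i j : Fin 5) : Bool :=
  decide (i ≠ j ∧ ∃ S ∈ 𝒟, S ≠ B ∧ f i ∈ S ∧ f j ∈ S ∧ p ∈ S)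

theorem pointGraph_self (B : Finset (Fin 11)) (f : Fin 5 → Fin 11) (p : Fin 11) (i : Fin 5) :
    pointGraph 𝒟 B f p i i = false := by
  simp [pointGraph]

theorem pointGraph_comm (B : Finset (Fin 11)) (f : Fin 5 → Fin 11) (p : Fin 11) (i j : Fin 5) :
    pointGraph 𝒟 B f p i j = pointGraph 𝒟 B f p j i := by
  simp only [pointGraph, decide_eq_decide]
  grind

variable {B : Finset (Fin 11)} {f : Fin 5 → Fin 11}

theorem card_filter_mem_of_ne (hcard : ∀ S ∈ 𝒟, #S = 5)
    (hpairs : ∀ x y : Fin 11, x ≠ y → #{S ∈ 𝒟 | x ∈ S ∧ y ∈ S} = 2) (hB : B ∈ 𝒟)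
    (hf : Function.Injective f) (hfB : univ.image f = B) {S : Finset (Fin 11)} (hS : S ∈ 𝒟)
    (hSB : S ≠ B) : #{i | f i ∈ S} = 2 := by
  rw [← card_inter_of_ne hcard hpairs hB hS hSB, ← card_image_of_injective _ hf, ← hfB]
  congr 1
  ext x
  simp only [mem_image, mem_filter, mem_univ, true_and, mem_inter]
  grind

theorem card_pointGraph (hcard : ∀ S ∈ 𝒟, #S = 5)
    (hpairs : ∀ x y : Fin 11, x ≠ y → #{S ∈ 𝒟 | x ∈ S ∧ y ∈ S} = 2) (hB : B ∈ 𝒟)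
    (hf : Function.Injective f) (hfB : univ.image f = B) {p : Fin 11} (hp : p ∉ B) (i : Fin 5) :
    #{j | pointGraph 𝒟 B f p i j} = 2 := by
  have hmem : ∀ i, f i ∈ B := fun i => hfB ▸ mem_image_of_mem f (mem_univ i)
  have h : ({j | pointGraph 𝒟 B f p i j} : Finset (Fin 5)) =
      ({S ∈ 𝒟 | f i ∈ S ∧ p ∈ S}).biUnion fun S => ({j | f j ∈ S} : Finset (Fin 5)).erase i := by
    ext j
    simp only [pointGraph, mem_filter, mem_univ, true_and, mem_biUnion, mem_erase,
      decide_eq_true_eq]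
    grind
  rw [h, card_biUnion, sum_const_nat (m := 1), hpairs _ _ (ne_of_mem_of_not_mem (hmem i) hp)]
  · intro S hS
    simp only [mem_filter] at hS
    rw [card_erase_of_mem (by simp [hS.2.1]),
      card_filter_mem_of_ne hcard hpairs hB hf hfB hS.1 (fun h => hp (h ▸ hS.2.2))]
  · intro S hS T hT hST
    simp only [mem_coe, mem_filter] at hS hT
    refine disjoint_left.2 fun j hjS hjT => hST ?_
    simp only [mem_erase, mem_filter, mem_univ, true_and] at hjS hjT
    exact eq_of_mem_of_mem hpairs hB hS.1 hT.1 (fun h => hp (h ▸ hS.2.2))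
      (fun h => hp (h ▸ hT.2.2)) (hf.ne hjS.1) (hmem j) (hmem i) hjS.2 hS.2.1 hjT.2 hT.2.1

theorem card_pointGraph_inter (hcard : ∀ S ∈ 𝒟, #S = 5)
    (hpairs : ∀ x y : Fin 11, x ≠ y → #{S ∈ 𝒟 | x ∈ S ∧ y ∈ S} = 2) (hB : B ∈ 𝒟)
    (hf : Function.Injective f) (hfB : univ.image f = B) {p q : Fin 11} (hp : p ∉ B)
    (hpq : p ≠ q) :
    #{x : Fin 5 × Fin 5 | pointGraph 𝒟 B f p x.1 x.2 ∧ pointGraph 𝒟 B f q x.1 x.2} = 4 := by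
  have hmem : ∀ i, f i ∈ B := fun i => hfB ▸ mem_image_of_mem f (mem_univ i)
  have h : ({x | pointGraph 𝒟 B f p x.1 x.2 ∧ pointGraph 𝒟 B f q x.1 x.2} :
      Finset (Fin 5 × Fin 5)) =
      ({S ∈ 𝒟 | p ∈ S ∧ q ∈ S}).biUnion fun S => ({j | f j ∈ S} : Finset (Fin 5)).offDiag := by
    ext ⟨i, j⟩
    simp only [pointGraph, mem_filter, mem_univ, true_and, mem_biUnion, mem_offDiag,
      decide_eq_true_eq]
    constructor
    · rintro ⟨⟨hij, S, hS, hSB, hiS, hjS, hpS⟩, -, T, hT, hTB, hiT, hjT, hqT⟩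
      obtain rfl := eq_of_mem_of_mem hpairs hB hS hT hSB hTB (hf.ne hij) (hmem i) (hmem j)
        hiS hjS hiT hjT
      exact ⟨S, ⟨hS, hpS, hqT⟩, hiS, hjS, hij⟩
    · rintro ⟨S, ⟨hS, hpS, hqS⟩, hiS, hjS, hij⟩
      have hSB : S ≠ B := fun h => hp (h ▸ hpS)
      exact ⟨⟨hij, S, hS, hSB, hiS, hjS, hpS⟩, hij, S, hS, hSB, hiS, hjS, hqS⟩
  rw [h, card_biUnion, sum_const_nat (m := 2), hpairs _ _ hpq]
  · intro S hS
    simp only [mem_filter] at hS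
    rw [offDiag_card,
      card_filter_mem_of_ne hcard hpairs hB hf hfB hS.1 (fun h => hp (h ▸ hS.2.1))]
  · intro S hS T hT hST
    simp only [mem_coe, mem_filter] at hS hT
    refine disjoint_left.2 fun x hxS hxT => hST ?_
    simp only [mem_offDiag, mem_filter, mem_univ, true_and] at hxS hxT
    exact eq_of_mem_of_mem hpairs hB hS.1 hT.1 (fun h => hp (h ▸ hS.2.1))
      (fun h => hp (h ▸ hT.2.1)) (hf.ne hxS.2.2) (hmem _) (hmem _) hxS.1 hxS.2.1 hxT.1 hxT.2.1

/-- A block can be enumerated so that a given outside point has the same graph as `0`. -/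
theorem exists_enumeration (hcard : ∀ S ∈ 𝒟, #S = 5)
    (hpairs : ∀ x y : Fin 11, x ≠ y → #{S ∈ 𝒟 | x ∈ S ∧ y ∈ S} = 2) (hB : B ∈ 𝒟)
    {p : Fin 11} (hp : p ∉ B) :
    ∃ f : Fin 5 → Fin 11, Function.Injective f ∧ univ.image f = B ∧
      ∀ i j, pointGraph 𝒟 B f p i j = residueGraph 0 i j := by
  have hg : univ.image (B.orderEmbOfFin (hcard B hB)) = B := image_orderEmbOfFin_univ _ _
  have hginj := (B.orderEmbOfFin (hcard B hB)).injective
  obtain ⟨σ, hσ⟩ := exists_perm_eq_residueGraph_zero (pointGraph_self B _ p)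
    (pointGraph_comm B _ p) (card_pointGraph hcard hpairs hB hginj hg hp)
  refine ⟨B.orderEmbOfFin (hcard B hB) ∘ σ, hginj.comp σ.injective, ?_, fun i j => ?_⟩
  · rw [← image_image, image_univ_equiv, hg]
  · rw [← hσ]
    simp [pointGraph]

end Design

/-- The (11,5,2) biplane is unique up to renaming of points: any family of 5-element
subsets of `Fin 11` in which every pair of distinct points lies in exactly two members
is carried onto `biplane` by some bijection `Fin 11 ≃ ZMod 11`. -/
theorem biplane_unique (𝒫' : Finset (Finset (Fin 11)))
    (hcard : ∀ S ∈ 𝒫', S.card = 5)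
    (hpairs : ∀ x y : Fin 11, x ≠ y →
      (𝒫'.filter fun S => x ∈ S ∧ y ∈ S).card = 2) :
    ∃ e : Fin 11 ≃ ZMod 11, 𝒫'.image (fun S => S.image e) = biplane := by
  obtain ⟨B, hB⟩ : 𝒫'.Nonempty := card_pos.1 (by rw [card_blocks hcard hpairs]; norm_num)
  obtain ⟨p, hp⟩ : ∃ p, p ∉ B := by
    by_contra! h
    have := hcard B hB
    rw [eq_univ_iff_forall.2 h] at this
    simp at this
  obtain ⟨f, hf, hfB, hf0⟩ := exists_enumeration hcard hpairs hB hp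
  have hres : Function.Injective residue := by decide
  have hresQ : ∀ i, residue i ∈ Q := by decide
  have hw : ∀ x, ∃ w, x ∉ B → w ∉ Q ∧ ∀ i j, pointGraph 𝒫' B f x i j = residueGraph w i j := by
    intro x
    by_cases hx : x ∈ B
    · exact ⟨0, fun h => absurd hx h⟩
    by_cases hxp : x = p
    · subst hxp
      exact ⟨0, fun _ => ⟨by decide, hf0⟩⟩
    have hs := card_pointGraph_inter hcard hpairs hB hf hfB hx hxp
    simp only [hf0] at hs
    obtain ⟨w, h⟩ := exists_eq_residueGraph (pointGraph_self B f x) (pointGraph_comm B f x)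
      (card_pointGraph hcard hpairs hB hf hfB hx) hs
    exact ⟨w, fun _ => h⟩
  choose w hw using hw
  have hv : ∀ x, ∃ z, (∀ i, f i = x → z = residue i) ∧ (x ∉ B → z = w x) := by
    intro x
    by_cases hx : x ∈ B
    · obtain ⟨i, -, rfl⟩ := mem_image.1 (hfB ▸ hx)
      exact ⟨residue i, fun j hj => by rw [hf hj], fun h => absurd hx h⟩
    · refine ⟨w x, fun i hi => absurd ?_ hx, fun _ => rfl⟩
      rw [← hi, ← hfB]
      exact mem_image_of_mem f (mem_univ i)
  choose v hvB hvw using hv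
  have hvf : ∀ i, v (f i) = residue i := fun i => hvB _ i rfl
  have hfrange : ∀ x ∈ B, ∃ i, f i = x := by
    intro x hx
    simpa [← hfB] using hx
  have hinj : Function.Injective v := by
    intro x y hxy
    by_cases hx : x ∈ B <;> by_cases hy : y ∈ B
    · obtain ⟨i, rfl⟩ := hfrange x hx
      obtain ⟨j, rfl⟩ := hfrange y hy
      rw [hvf, hvf] at hxy
      rw [hres hxy]
    · obtain ⟨i, rfl⟩ := hfrange x hx
      rw [hvf, hvw y hy] at hxy
      exact absurd (hxy ▸ hresQ i) (hw y hy).1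
    · obtain ⟨j, rfl⟩ := hfrange y hy
      rw [hvf, hvw x hx] at hxy
      exact absurd (hxy ▸ hresQ j) (hw x hx).1
    · rw [hvw x hx, hvw y hy] at hxy
      by_contra hne
      have hs := card_pointGraph_inter hcard hpairs hB hf hfB hx hne
      simp only [(hw x hx).2, (hw y hy).2, hxy, and_self] at hs
      have hd : ∀ z, z ∉ Q → #{a : Fin 5 × Fin 5 | residueGraph z a.1 a.2} ≠ 4 := by
        decide +kernel
      exact hd _ (hw y hy).1 hs
  have hbij : Function.Bijective v :=
    (Fintype.bijective_iff_injective_and_card v).2 ⟨hinj, by simp⟩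
  refine ⟨Equiv.ofBijective v hbij, eq_of_subset_of_card_le ?_ ?_⟩
  · have htcard : ∀ t : ZMod 11, #(Q.image (· + t)) = 5 := by decide +kernel
    have hsub : ∀ S ∈ 𝒫', ∃ t : ZMod 11, S.image v ⊆ Q.image (· + t) := by
      intro S hS
      by_cases hSB : S = B
      · refine ⟨0, ?_⟩
        subst hSB
        intro z hz
        obtain ⟨x, hx, rfl⟩ := mem_image.1 hz
        obtain ⟨i, rfl⟩ := hfrange x hx
        simpa [hvf] using hresQ i
      obtain ⟨i, j, hij, hT⟩ := card_eq_two.1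
        (card_filter_mem_of_ne hcard hpairs hB hf hfB hS hSB)
      have hiff : ∀ k, f k ∈ S ↔ k = i ∨ k = j := fun k => by
        simpa using Finset.ext_iff.1 hT k
      obtain ⟨t, hit, hjt, ht⟩ := exists_translate_of_residues i j hij
      refine ⟨t, fun z hz => ?_⟩
      obtain ⟨x, hx, rfl⟩ := mem_image.1 hz
      by_cases hxB : x ∈ B
      · obtain ⟨k, rfl⟩ := hfrange x hxB
        rw [hvf]
        rcases (hiff k).1 hx with rfl | rfl <;> assumption
      · have hadj : pointGraph 𝒫' B f x i j = true :=
          decide_eq_true ⟨hij, S, hS, hSB, (hiff i).2 (.inl rfl), (hiff j).2 (.inr rfl), hx⟩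
        rw [(hw x hxB).2] at hadj
        obtain ⟨-, s, hs, his, hjs, hws⟩ := of_decide_eq_true hadj
        rw [hvw x hxB, ← ht s hs his hjs]
        exact hws
    intro U hU
    obtain ⟨S, hS, rfl⟩ := mem_image.1 hU
    obtain ⟨t, ht⟩ := hsub S hS
    refine mem_image.2 ⟨t, mem_univ t, (eq_of_subset_of_card_le ht ?_).symm⟩
    rw [htcard, card_image_of_injective _ hinj, hcard S hS]
  · rw [card_image_of_injective _ (image_injective (Equiv.injective _)), card_blocks hcard hpairs]
    decide +kernel
end

section
/- Let 𝒫 be the (11,5,2) biplane of translates of the quadratic residues modulo 11, and let G be the subgroup of Equiv.Perm (ZMod 11) consisting of those permutations σ such that the image σ(B) of every block B ∈ 𝒫 is again a block of 𝒫. Then G has cardinality 660. -/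
open Finset

/-- The block `Q + t` of the biplane. -/
def block (t : ZMod 11) : Finset (ZMod 11) := Q.image (· + t)

theorem mem_biplane {B : Finset (ZMod 11)} : B ∈ biplane ↔ ∃ t, block t = B := by
  simp [biplane, block]

theorem mem_block {x t : ZMod 11} : x ∈ block t ↔ x - t ∈ Q := by
  simp [block, sub_eq_add_neg]

theorem card_block (t : ZMod 11) : (block t).card = 5 :=
  card_image_of_injective Q (add_left_injective t)

/-- A permutation mapping the points of every block into some block preserves the biplane. -/
theorem image_mem_biplane {σ : Equiv.Perm (ZMod 11)}
    (hσ : ∀ t, ∃ s, ∀ q ∈ Q, σ (q + t) - s ∈ Q) : ∀ B ∈ biplane, B.image σ ∈ biplane := by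
  intro B hB
  obtain ⟨t, rfl⟩ := mem_biplane.1 hB
  obtain ⟨s, hs⟩ := hσ t
  refine mem_biplane.2 ⟨s, (eq_of_subset_of_card_le ?_ ?_).symm⟩
  · intro y hy
    obtain ⟨x, hx, rfl⟩ := mem_image.1 hy
    rw [mem_block] at hx ⊢
    simpa using hs _ hx
  · rw [card_image_of_injective _ σ.injective, card_block, card_block]

/-- Three points of `ZMod 11` are concurrent when some block of the biplane contains them. -/
def Concurrent (a b c : ZMod 11) : Prop :=
  ∃ t, a - t ∈ Q ∧ b - t ∈ Q ∧ c - t ∈ Q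

instance (a b c : ZMod 11) : Decidable (Concurrent a b c) :=
  inferInstanceAs (Decidable (∃ t, a - t ∈ Q ∧ b - t ∈ Q ∧ c - t ∈ Q))

/-- The ordered triples of distinct points lying in a common block. -/
def concurrentTriples : Finset (ZMod 11 × ZMod 11 × ZMod 11) :=
  {t | t.1 ≠ t.2.1 ∧ t.1 ≠ t.2.2 ∧ t.2.1 ≠ t.2.2 ∧ Concurrent t.1 t.2.1 t.2.2}

theorem card_concurrentTriples_le : concurrentTriples.card ≤ 660 := by
  let T := {u ∈ Q ×ˢ Q ×ˢ Q | u.1 ≠ u.2.1 ∧ u.1 ≠ u.2.2 ∧ u.2.1 ≠ u.2.2}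
  have hT : T.card = 60 := by decide +kernel
  have hsub : concurrentTriples ⊆ ((univ : Finset (ZMod 11)) ×ˢ T).image
      fun p => (p.2.1 + p.1, p.2.2.1 + p.1, p.2.2.2 + p.1) := by
    rintro ⟨a, b, c⟩ h
    obtain ⟨hab, hac, hbc, t, ha, hb, hc⟩ := (mem_filter.1 h).2
    refine mem_image.2 ⟨(t, a - t, b - t, c - t), ?_, by simp⟩
    simp only [mem_product, mem_univ, true_and, T, mem_filter]
    exact ⟨⟨ha, hb, hc⟩, by simpa using hab, by simpa using hac, by simpa using hbc⟩
  calc concurrentTriples.card ≤ ((univ : Finset (ZMod 11)) ×ˢ T).card :=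
        (card_le_card hsub).trans card_image_le
    _ = 660 := by rw [card_product, hT, card_univ, ZMod.card]

theorem Concurrent.map {σ : Equiv.Perm (ZMod 11)} (hσ : ∀ B ∈ biplane, B.image σ ∈ biplane)
    {a b c : ZMod 11} (h : Concurrent a b c) : Concurrent (σ a) (σ b) (σ c) := by
  obtain ⟨t, ht⟩ := h
  obtain ⟨s, hs⟩ := mem_biplane.1 (hσ (block t) (mem_biplane.2 ⟨t, rfl⟩))
  have key : ∀ {x}, x - t ∈ Q → σ x - s ∈ Q := fun hx => by
    rw [← mem_block, hs]
    exact mem_image_of_mem σ (mem_block.2 hx)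
  exact ⟨s, key ht.1, key ht.2.1, key ht.2.2⟩

theorem eq_two_of_concurrent_iff : ∀ w : ZMod 11,
    (Concurrent 1 3 w ↔ Concurrent 1 3 2) → (Concurrent 1 4 w ↔ Concurrent 1 4 2) →
    (Concurrent 3 4 w ↔ Concurrent 3 4 2) → w = 2 := by
  decide +kernel

theorem eq_of_concurrent_iff : ∀ v w : ZMod 11, v ∉ ({1, 3, 4} : Finset (ZMod 11)) →
    w ∉ ({1, 3, 4} : Finset (ZMod 11)) →
    (Concurrent 1 3 w ↔ Concurrent 1 3 v) → (Concurrent 1 4 w ↔ Concurrent 1 4 v) →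
    (Concurrent 3 4 w ↔ Concurrent 3 4 v) → (Concurrent 1 2 w ↔ Concurrent 1 2 v) → w = v := by
  decide +kernel

/-- A permutation preserving concurrency and fixing `1`, `3` and `4` is the identity. -/
theorem eq_one_of_fixes {σ : Equiv.Perm (ZMod 11)}
    (hσ : ∀ a b c, Concurrent (σ a) (σ b) (σ c) ↔ Concurrent a b c)
    (h1 : σ 1 = 1) (h3 : σ 3 = 3) (h4 : σ 4 = 4) : σ = 1 := by
  have key : ∀ {a b}, σ a = a → σ b = b → ∀ v, Concurrent a b (σ v) ↔ Concurrent a b v := by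
    intro a b ha hb v
    simpa only [ha, hb] using hσ a b v
  have h2 : σ 2 = 2 := eq_two_of_concurrent_iff _ (key h1 h3 2) (key h1 h4 2) (key h3 h4 2)
  ext1 v
  by_cases hv : v ∈ ({1, 3, 4} : Finset (ZMod 11))
  · simp only [mem_insert, mem_singleton] at hv
    rcases hv with rfl | rfl | rfl <;> simpa
  · refine eq_of_concurrent_iff v (σ v) hv ?_ (key h1 h3 v) (key h1 h4 v) (key h3 h4 v)
      (key h1 h2 v)
    simp only [mem_insert, mem_singleton, not_or] at hv ⊢
    refine ⟨fun h => hv.1 (σ.injective (h.trans h1.symm)),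
      fun h => hv.2.1 (σ.injective (h.trans h3.symm)),
      fun h => hv.2.2 (σ.injective (h.trans h4.symm))⟩

/-- Multiplication by `3`, an automorphism of order `5`. -/
def mulThree : Equiv.Perm (ZMod 11) :=
  ⟨fun x => 3 * x, fun x => 4 * x, by decide, by decide⟩

/-- An automorphism of order `3`. -/
def autThree : Equiv.Perm (ZMod 11) :=
  Equiv.swap 0 3 * Equiv.swap 3 1 * (Equiv.swap 4 10 * Equiv.swap 10 6) *
    (Equiv.swap 7 9 * Equiv.swap 9 8)

/-- An automorphism of order `2`, commuting with `autTwoComm`. -/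
def autTwo : Equiv.Perm (ZMod 11) :=
  Equiv.swap 0 1 * Equiv.swap 2 5 * Equiv.swap 6 10 * Equiv.swap 8 9

/-- An automorphism of order `2`, commuting with `autTwo`. -/
def autTwoComm : Equiv.Perm (ZMod 11) :=
  Equiv.swap 0 1 * Equiv.swap 4 7 * Equiv.swap 6 9 * Equiv.swap 8 10

theorem image_addRight_mem_biplane : ∀ B ∈ biplane,
    B.image (Equiv.addRight (1 : ZMod 11)) ∈ biplane :=
  image_mem_biplane (by decide +kernel)

theorem image_mulThree_mem_biplane : ∀ B ∈ biplane, B.image mulThree ∈ biplane :=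
  image_mem_biplane (by decide +kernel)

theorem image_autThree_mem_biplane : ∀ B ∈ biplane, B.image autThree ∈ biplane :=
  image_mem_biplane (by decide +kernel)

theorem image_autTwo_mem_biplane : ∀ B ∈ biplane, B.image autTwo ∈ biplane :=
  image_mem_biplane (by decide +kernel)

theorem image_autTwoComm_mem_biplane : ∀ B ∈ biplane, B.image autTwoComm ∈ biplane :=
  image_mem_biplane (by decide +kernel)

/-- A subgroup containing an element of prime order `p` has cardinality divisible by `p`. -/
theorem prime_dvd_natCard {A : Type*} [Group A] {G : Subgroup A} {x : A} (hx : x ∈ G)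
    {p : ℕ} (hp : p.Prime) (hpow : x ^ p = 1) (hne : x ≠ 1) : p ∣ Nat.card G := by
  have := Fact.mk hp
  rw [← orderOf_eq_prime hpow hne]
  exact Subgroup.orderOf_dvd_natCard G hx

/-- A subgroup containing two distinct commuting involutions has cardinality divisible by `4`. -/
theorem four_dvd_natCard {A : Type*} [Group A] {G : Subgroup A} {a b : A} (ha : a ∈ G)
    (hb : b ∈ G) (haa : a * a = 1) (hbb : b * b = 1) (hab : b * a = a * b)
    (ha1 : a ≠ 1) (hb1 : b ≠ 1) (hne : a ≠ b) : 4 ∣ Nat.card G := by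
  classical
  have haa' : ∀ x, a * (a * x) = x := fun x => by rw [← mul_assoc, haa, one_mul]
  have hab' : ∀ x, b * (a * x) = a * (b * x) := fun x => by rw [← mul_assoc, hab, mul_assoc]
  have hab1 : a * b ≠ 1 := fun h => hne (mul_left_cancel (haa.trans h.symm))
  let V : Subgroup A :=
    { carrier := ↑({1, a, b, a * b} : Finset A)
      one_mem' := by simp
      mul_mem' := by
        intro x y hx hy
        simp only [coe_insert, coe_singleton, Set.mem_insert_iff, Set.mem_singleton_iff] at hx hy ⊢
        rcases hx with rfl | rfl | rfl | rfl <;> rcases hy with rfl | rfl | rfl | rfl <;>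
          simp [mul_assoc, haa, hbb, hab, haa', hab']
      inv_mem' := by
        intro x hx
        simp only [coe_insert, coe_singleton, Set.mem_insert_iff, Set.mem_singleton_iff] at hx ⊢
        have hx2 : x * x = 1 := by
          rcases hx with rfl | rfl | rfl | rfl <;> simp [mul_assoc, haa, hbb, hab']
        rwa [inv_eq_of_mul_eq_one_right hx2] }
  have hV : Nat.card V = 4 := by
    change Nat.card (({1, a, b, a * b} : Finset A) : Set A) = 4
    rw [Nat.card_coe_set_eq, Set.ncard_coe_finset, card_insert_of_notMem, card_insert_of_notMem,
      card_pair] <;> simp [ha1, hb1, hne, ha1.symm, hb1.symm, hab1.symm]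
  rw [← hV]
  refine Subgroup.card_dvd_of_le fun x hx => ?_
  have hx' : x ∈ ({1, a, b, a * b} : Finset A) := hx
  simp only [mem_insert, mem_singleton] at hx'
  rcases hx' with rfl | rfl | rfl | rfl
  exacts [G.one_mem, ha, hb, G.mul_mem ha hb]

/-- The automorphism group of the (11,5,2) biplane — the subgroup of permutations of
`ZMod 11` mapping every block of the biplane to a block — has order 660. -/
theorem biplane_aut_card (G : Subgroup (Equiv.Perm (ZMod 11)))
    (hG : ∀ σ : Equiv.Perm (ZMod 11),
      σ ∈ G ↔ ∀ B ∈ biplane, B.image σ ∈ biplane) :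
    Nat.card G = 660 := by
  have hconc : ∀ σ ∈ G, ∀ a b c, Concurrent (σ a) (σ b) (σ c) ↔ Concurrent a b c := by
    refine fun σ hσ a b c => ⟨fun h => ?_, Concurrent.map ((hG σ).1 hσ)⟩
    simpa using h.map ((hG σ⁻¹).1 (G.inv_mem hσ))
  have hle : Nat.card G ≤ 660 := by
    let f : G → concurrentTriples := fun σ => ⟨(σ.1 1, σ.1 3, σ.1 4), by
      have h134 : (1 : ZMod 11) ≠ 3 ∧ (1 : ZMod 11) ≠ 4 ∧ (3 : ZMod 11) ≠ 4 ∧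
          Concurrent 1 3 4 := by
        decide +kernel
      simpa [concurrentTriples, hconc σ.1 σ.2] using h134⟩
    have hf : Function.Injective f := by
      intro σ τ h
      simp only [f, Subtype.mk.injEq, Prod.mk.injEq] at h
      have h_one := eq_one_of_fixes (hconc (τ⁻¹ * σ : G) (τ⁻¹ * σ).2)
        (by simp [h.1]) (by simp [h.2.1]) (by simp [h.2.2])
      exact (inv_mul_eq_one.1 (Subtype.ext h_one)).symm
    calc Nat.card G ≤ Nat.card concurrentTriples := Nat.card_le_card_of_injective f hf
      _ ≤ 660 := by
        rw [Nat.card_eq_finsetCard]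
        exact card_concurrentTriples_le
  have h11 : 11 ∣ Nat.card G := prime_dvd_natCard (x := Equiv.addRight 1)
    ((hG _).2 image_addRight_mem_biplane) (by norm_num) (by decide +kernel) (by decide +kernel)
  have h5 : 5 ∣ Nat.card G := prime_dvd_natCard (x := mulThree)
    ((hG _).2 image_mulThree_mem_biplane) (by norm_num) (by decide +kernel) (by decide +kernel)
  have h3 : 3 ∣ Nat.card G := prime_dvd_natCard (x := autThree)
    ((hG _).2 image_autThree_mem_biplane) (by norm_num) (by decide +kernel) (by decide +kernel)
  have h4 : 4 ∣ Nat.card G := four_dvd_natCard ((hG _).2 image_autTwo_mem_biplane)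
    ((hG _).2 image_autTwoComm_mem_biplane) (by decide +kernel) (by decide +kernel)
    (by decide +kernel) (by decide +kernel) (by decide +kernel) (by decide +kernel)
  have hpos : 0 < Nat.card G := Nat.card_pos
  omega
end

section
/- Let 𝒫 be the (11,5,2) biplane of translates of the quadratic residues modulo 11, and let G be the subgroup of Equiv.Perm (ZMod 11) consisting of those permutations σ such that the image σ(B) of every block B ∈ 𝒫 is again a block of 𝒫. Then G is isomorphic as a group to PSL₂(𝔽₁₁), i.e., to the quotient of Matrix.SpecialLinearGroup (Fin 2) (ZMod 11) by its center. -/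
open Finset

lemma fact_prime_eleven : Fact (Nat.Prime 11) := ⟨by norm_num⟩

section ProjectiveLine

attribute [local instance] fact_prime_eleven

local instance : DecidableEq (OnePoint (ZMod 11)) :=
  inferInstanceAs (DecidableEq (Option (ZMod 11)))

open scoped OnePoint in
/-- The `i`-th of eleven perfect matchings of the projective line over `𝔽₁₁` that `PSL₂(𝔽₁₁)`
permutes. It pairs `∞` with `i`, and `i + x` with `i + 2 * x` for every nonzero square `x`. -/
def matching (i : ZMod 11) (x : OnePoint (ZMod 11)) : OnePoint (ZMod 11) :=
  x.elim (i : OnePoint (ZMod 11)) fun y =>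
    if y = i then ∞ else if y - i ∈ Q then ((i + 2 * (y - i) : ZMod 11) : OnePoint (ZMod 11))
    else ((i + 6 * (y - i) : ZMod 11) : OnePoint (ZMod 11))

@[simp]
lemma matching_infty (i : ZMod 11) : matching i OnePoint.infty = i := rfl

/-- The matrix `g` carries the `i`-th matching to the `σ i`-th one. -/
def PermutesMatchings (g : Matrix.SpecialLinearGroup (Fin 2) (ZMod 11))
    (σ : Equiv.Perm (ZMod 11)) : Prop :=
  ∀ i x, g.toGL • matching i x = matching (σ i) (g.toGL • x)

namespace PermutesMatchings

variable {g h : Matrix.SpecialLinearGroup (Fin 2) (ZMod 11)} {σ τ : Equiv.Perm (ZMod 11)}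

lemma mul (hg : PermutesMatchings g σ) (hh : PermutesMatchings h τ) :
    PermutesMatchings (g * h) (σ * τ) := fun i x => by
  rw [map_mul, mul_smul, mul_smul, hh, hg, Equiv.Perm.mul_apply]

lemma unique (hg : PermutesMatchings g σ) (hg' : PermutesMatchings g τ) : σ = τ := by
  ext1 i
  have h := (hg i (g.toGL⁻¹ • OnePoint.infty)).symm.trans (hg' i _)
  simpa using h

end PermutesMatchings

/-- The permutation of the eleven matchings induced by `x ↦ -1 / x`. -/
def inversionPerm : Equiv.Perm (ZMod 11) :=
  Equiv.swap 1 9 * Equiv.swap 2 6 * Equiv.swap 4 5 * Equiv.swap 7 8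

/-- The matrix of the Möbius transformation `x ↦ -1 / x`. -/
def inversionMatrix : Matrix.SpecialLinearGroup (Fin 2) (ZMod 11) :=
  ⟨!![0, -1; 1, 0], by simp⟩

lemma permutesMatchings_inversion : PermutesMatchings inversionMatrix inversionPerm := by
  have hM : (inversionMatrix.toGL : Matrix (Fin 2) (Fin 2) (ZMod 11)) = !![0, -1; 1, 0] := rfl
  have h0 : inversionMatrix.toGL • (OnePoint.infty : OnePoint (ZMod 11)) = (0 : ZMod 11) := by
    rw [OnePoint.smul_infty_eq_ite]; simp [hM]
  have h1 (k : ZMod 11) : inversionMatrix.toGL • (k : OnePoint (ZMod 11)) =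
      if k = 0 then OnePoint.infty else ((-k ^ 9 : ZMod 11) : OnePoint (ZMod 11)) := by
    rw [OnePoint.smul_some_eq_ite]
    have : k ≠ 0 → -1 / k = -k ^ 9 := by revert k; decide +kernel
    simp +contextual [hM, this]
  have h2 : ∀ x : OnePoint (ZMod 11), inversionMatrix.toGL • x = x.elim
      ((0 : ZMod 11) : OnePoint (ZMod 11))
      fun k => if k = 0 then OnePoint.infty else ((-k ^ 9 : ZMod 11) : OnePoint (ZMod 11)) :=
    fun x => OnePoint.rec h0 h1 x
  unfold PermutesMatchings
  simp only [h2]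
  decide +kernel

lemma permutesMatchings_transvection (a : ZMod 11) :
    PermutesMatchings (.transvection (zero_ne_one (α := Fin 2)) a) (Equiv.addRight a) := by
  have h0 : (Matrix.SpecialLinearGroup.transvection (zero_ne_one (α := Fin 2)) a).toGL •
      (OnePoint.infty : OnePoint (ZMod 11)) = OnePoint.infty := by
    rw [OnePoint.smul_infty_eq_ite]
    simp [Matrix.SpecialLinearGroup.transvection_coe]
  have h1 (k : ZMod 11) : (Matrix.SpecialLinearGroup.transvection (zero_ne_one (α := Fin 2)) a).toGL
      • (k : OnePoint (ZMod 11)) = ((k + a : ZMod 11) : OnePoint (ZMod 11)) := by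
    rw [OnePoint.smul_some_eq_ite]
    simp [Matrix.SpecialLinearGroup.transvection_coe]
  intro i x
  induction x with
  | infty => simp [h0, h1]
  | coe x =>
    simp only [h1, matching, OnePoint.elim_some, Equiv.coe_addRight, add_left_inj,
      add_sub_add_right_eq_sub]
    split_ifs <;> simp only [h0, h1] <;> congr 1 <;> ring

lemma transvection_one_zero (a : ZMod 11) :
    Matrix.SpecialLinearGroup.transvection (one_ne_zero (α := Fin 2)) a =
      inversionMatrix * .transvection (zero_ne_one (α := Fin 2)) (-a) *
        (inversionMatrix * inversionMatrix * inversionMatrix) := by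
  have hM : (inversionMatrix : Matrix (Fin 2) (Fin 2) (ZMod 11)) = !![0, -1; 1, 0] := rfl
  refine Subtype.ext ?_
  simp only [Matrix.SpecialLinearGroup.coe_mul, Matrix.SpecialLinearGroup.transvection_coe, hM]
  ext i j
  fin_cases i <;> fin_cases j <;> simp [Matrix.mul_apply, Matrix.vecMul, dotProduct]

/-- A subgroup containing the permutations induced by `x ↦ -1 / x` and by the translations
contains the permutation induced by every matrix. -/
lemma exists_permutesMatchings {H : Subgroup (Equiv.Perm (ZMod 11))} (hs : inversionPerm ∈ H)
    (ht : ∀ a, Equiv.addRight a ∈ H) (g : Matrix.SpecialLinearGroup (Fin 2) (ZMod 11)) :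
    ∃ σ ∈ H, PermutesMatchings g σ := by
  refine Matrix.SL2.transvection_induction (fun g => ∃ σ ∈ H, PermutesMatchings g σ)
    (fun i j hij a => ?_) ?_ g
  · have hi := permutesMatchings_inversion
    fin_cases i <;> fin_cases j
    · exact absurd rfl hij
    · exact ⟨_, ht a, permutesMatchings_transvection a⟩
    · refine ⟨_, ?_, (transvection_one_zero a).symm ▸
        (hi.mul (permutesMatchings_transvection (-a))).mul ((hi.mul hi).mul hi)⟩
      exact mul_mem (mul_mem hs (ht _)) (mul_mem (mul_mem hs hs) hs)
    · exact absurd rfl hij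
  · rintro g h ⟨σ, hσ, hg⟩ ⟨τ, hτ, hh⟩
    exact ⟨σ * τ, mul_mem hσ hτ, hg.mul hh⟩

lemma permutesMatchings_one_of_mem_center {g : Matrix.SpecialLinearGroup (Fin 2) (ZMod 11)}
    (hg : g ∈ Subgroup.center (Matrix.SpecialLinearGroup (Fin 2) (ZMod 11))) :
    PermutesMatchings g 1 := by
  obtain ⟨r, hr, hg⟩ := Matrix.SpecialLinearGroup.mem_center_iff.1 hg
  have hr0 : r ≠ 0 := by rintro rfl; simp at hr
  have h (x : OnePoint (ZMod 11)) : g.toGL • x = x := by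
    induction x with
    | infty => rw [OnePoint.smul_infty_eq_self_iff]; simp [← hg]
    | coe x => rw [OnePoint.smul_some_eq_ite]; simp [← hg, hr0]
  intro i x
  simp [h]

end ProjectiveLine

/-- An automorphism of the biplane permutes the blocks `Q + i`, compatibly with incidence. -/
lemma exists_block_map {σ : Equiv.Perm (ZMod 11)} (hσ : ∀ B ∈ biplane, B.image σ ∈ biplane) :
    ∃ τ : ZMod 11 → ZMod 11, ∀ i j, σ j - τ i ∈ Q ↔ j - i ∈ Q := by
  have h (i : ZMod 11) : ∃ k, ∀ j, σ j - k ∈ Q ↔ j - i ∈ Q := by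
    obtain ⟨k, -, hk⟩ := mem_image.1 (hσ (Q.image (· + i)) (mem_image_of_mem _ (mem_univ i)))
    have mem_translate (t x : ZMod 11) : x ∈ Q.image (· + t) ↔ x - t ∈ Q := by
      refine ⟨fun h => ?_, fun h => mem_image.2 ⟨_, h, sub_add_cancel x t⟩⟩
      obtain ⟨y, hy, rfl⟩ := mem_image.1 h
      simpa only [add_sub_cancel_right] using hy
    exact ⟨k, fun j => by
      rw [← mem_translate, hk, σ.injective.mem_finset_image, mem_translate]⟩
  choose τ hτ using h
  exact ⟨τ, hτ⟩

/-- An automorphism of the biplane that fixes `0`, `1` and `2` is trivial. -/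
lemma eq_one_of_fixes_s6 {σ : Equiv.Perm (ZMod 11)} (hσ : ∀ B ∈ biplane, B.image σ ∈ biplane)
    (h0 : σ 0 = 0) (h1 : σ 1 = 1) (h2 : σ 2 = 2) : σ = 1 := by
  obtain ⟨τ, hτ⟩ := exists_block_map hσ
  have hB : ∀ i ∈ ({5, 7, 8, 9, 10} : Finset (ZMod 11)), τ i = i := by
    have key : ∀ i ∈ ({5, 7, 8, 9, 10} : Finset (ZMod 11)), ∀ k, (0 - k ∈ Q ↔ 0 - i ∈ Q) →
      (1 - k ∈ Q ↔ 1 - i ∈ Q) → (2 - k ∈ Q ↔ 2 - i ∈ Q) → k = i := by decide +kernel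
    exact fun i hi => key i hi _ (by simpa [h0] using hτ i 0) (by simpa [h1] using hτ i 1)
      (by simpa [h2] using hτ i 2)
  have hP : ∀ j ∈ ({0, 1, 2, 3, 4, 5, 7, 8, 10} : Finset (ZMod 11)), σ j = j := by
    have key : ∀ j ∈ ({3, 4, 5, 7, 8, 10} : Finset (ZMod 11)), ∀ k,
      (∀ i ∈ ({5, 7, 8, 9, 10} : Finset (ZMod 11)), k - i ∈ Q ↔ j - i ∈ Q) → k = j := by
      decide +kernel
    have h (j) (hj : j ∈ ({3, 4, 5, 7, 8, 10} : Finset (ZMod 11))) : σ j = j :=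
      key j hj _ fun i hi => by simpa [hB i hi] using hτ i j
    intro j hj
    simp only [mem_insert, mem_singleton] at hj h
    grind
  have hB' (i) : τ i = i := by
    have key : ∀ i k : ZMod 11, (∀ j ∈ ({0, 1, 2, 3, 4, 5, 7, 8, 10} : Finset (ZMod 11)),
      j - k ∈ Q ↔ j - i ∈ Q) → k = i := by decide +kernel
    exact key _ _ fun j hj => by simpa [hP j hj] using hτ i j
  ext1 j
  have key : ∀ j k : ZMod 11, (∀ i, k - i ∈ Q ↔ j - i ∈ Q) → k = j := by decide +kernel
  exact key _ _ fun i => by simpa [hB'] using hτ i j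

/-- The product of the permutations `x ↦ inversionPerm x + a` over the entries `a` of a list. -/
def wordPerm (l : List (ZMod 11)) : Equiv.Perm (ZMod 11) :=
  (l.map fun a => Equiv.addRight a * inversionPerm).prod

/-- Every automorphism of the biplane lies in the group generated by `inversionPerm` and the
translations. -/
lemma mem_of_map_biplane {H : Subgroup (Equiv.Perm (ZMod 11))} (hs : inversionPerm ∈ H)
    (ht : ∀ a, Equiv.addRight a ∈ H) (hH : ∀ σ ∈ H, ∀ B ∈ biplane, B.image σ ∈ biplane)
    {σ : Equiv.Perm (ZMod 11)} (hσ : ∀ B ∈ biplane, B.image σ ∈ biplane) : σ ∈ H := by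
  have hw (l) : wordPerm l ∈ H := Subgroup.list_prod_mem _ fun τ hτ => by
    obtain ⟨a, -, rfl⟩ := List.mem_map.1 hτ
    exact mul_mem (ht a) hs
  have hcomp {τ ρ : Equiv.Perm (ZMod 11)} (hτ : ∀ B ∈ biplane, B.image τ ∈ biplane)
      (hρ : ∀ B ∈ biplane, B.image ρ ∈ biplane) : ∀ B ∈ biplane, B.image (τ * ρ) ∈ biplane :=
    fun B hB => by
      rw [Equiv.Perm.coe_mul, ← image_image]
      exact hτ _ (hρ B hB)
  have reduce {τ ρ : Equiv.Perm (ZMod 11)} (hρ : ρ ∈ H) (h : ρ⁻¹ * τ ∈ H) : τ ∈ H :=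
    (Subgroup.mul_mem_cancel_left H (inv_mem hρ)).1 h
  wlog h0 : σ 0 = 0 generalizing σ
  · exact reduce (ht (σ 0)) (this (hcomp (hH _ (inv_mem (ht _))) hσ) (by simp))
  wlog h1 : σ 1 = 1 generalizing σ
  · have key : ∀ q : ZMod 11, q ≠ 0 → ∃ l ∈ ([[], [0, 4, 8], [9, 6], [0, 5, 2], [5, 2], [4, 8],
        [3, 7], [1, 10], [0], [7, 5]] : List (List (ZMod 11))),
        wordPerm l 0 = 0 ∧ wordPerm l 1 = q := by decide +kernel
    obtain ⟨l, -, hl0, hl1⟩ := key (σ 1) fun h => absurd (σ.injective (h.trans h0.symm)) (by decide)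
    refine reduce (hw l) (this (hcomp (hH _ (inv_mem (hw l))) hσ) ?_ ?_)
    · rw [Equiv.Perm.mul_apply, h0, Equiv.Perm.inv_eq_iff_eq, hl0]
    · rw [Equiv.Perm.mul_apply, Equiv.Perm.inv_eq_iff_eq, hl1]
  have key : ∀ k q : ZMod 11, 0 - k ∈ Q → 1 - k ∈ Q → q - k ∈ Q → q ≠ 0 → q ≠ 1 →
      ∃ l ∈ ([[], [6, 4], [1, 5, 4], [0, 3, 4, 3], [4, 4, 5], [2, 1]] : List (List (ZMod 11))),
        wordPerm l 0 = 0 ∧ wordPerm l 1 = 1 ∧ wordPerm l 2 = q := by decide +kernel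
  obtain ⟨τ, hτ⟩ := exists_block_map hσ
  obtain ⟨l, -, hl0, hl1, hl2⟩ := key (τ 8) (σ 2) (h0 ▸ (hτ 8 0).2 (by decide))
    (h1 ▸ (hτ 8 1).2 (by decide)) ((hτ 8 2).2 (by decide))
    (fun h => absurd (σ.injective (h.trans h0.symm)) (by decide))
    (fun h => absurd (σ.injective (h.trans h1.symm)) (by decide))
  refine reduce (hw l) ?_
  rw [eq_one_of_fixes_s6 (hcomp (hH _ (inv_mem (hw l))) hσ) ?_ ?_ ?_]
  · exact one_mem H
  · rw [Equiv.Perm.mul_apply, h0, Equiv.Perm.inv_eq_iff_eq, hl0]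
  · rw [Equiv.Perm.mul_apply, h1, Equiv.Perm.inv_eq_iff_eq, hl1]
  · rw [Equiv.Perm.mul_apply, Equiv.Perm.inv_eq_iff_eq, hl2]

/-- The automorphism group of the (11,5,2) biplane — the subgroup of permutations of
`ZMod 11` mapping every block of the biplane to a block — is isomorphic to
`PSL₂(𝔽₁₁)`, the quotient of `SL₂(ZMod 11)` by its center. -/
theorem biplane_aut_iso_psl2 (G : Subgroup (Equiv.Perm (ZMod 11)))
    (hG : ∀ σ : Equiv.Perm (ZMod 11),
      σ ∈ G ↔ ∀ B ∈ biplane, B.image σ ∈ biplane) :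
    Nonempty (G ≃*
      (Matrix.SpecialLinearGroup (Fin 2) (ZMod 11) ⧸
        Subgroup.center (Matrix.SpecialLinearGroup (Fin 2) (ZMod 11)))) := by
  have hs : inversionPerm ∈ G := (hG _).2 (by decide +kernel)
  have ht (a : ZMod 11) : Equiv.addRight a ∈ G := (hG _).2 (by revert a; decide +kernel)
  have := fact_prime_eleven
  choose f hfG hf using exists_permutesMatchings hs ht
  let φ : Matrix.SpecialLinearGroup (Fin 2) (ZMod 11) →* G :=
    MonoidHom.mk' (fun g => ⟨f g, hfG g⟩)
      fun g h => Subtype.ext ((hf (g * h)).unique ((hf g).mul (hf h)))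
  have hφ {g σ} (h : PermutesMatchings g σ) : (φ g : Equiv.Perm (ZMod 11)) = σ := (hf g).unique h
  let ψ := QuotientGroup.lift (Subgroup.center _) φ fun g hg =>
    Subtype.ext (hφ (permutesMatchings_one_of_mem_center hg))
  have hsurj : Function.Surjective ψ := by
    refine QuotientGroup.lift_surjective_of_surjective _ φ (fun σ => ?_) _
    have hσ : (σ : Equiv.Perm (ZMod 11)) ∈ φ.range.map G.subtype :=
      mem_of_map_biplane (H := φ.range.map G.subtype) ⟨_, ⟨_, rfl⟩, hφ permutesMatchings_inversion⟩
        (fun a => ⟨_, ⟨_, rfl⟩, hφ (permutesMatchings_transvection a)⟩)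
        (fun τ ⟨ρ, _, h⟩ => (hG τ).1 (h ▸ ρ.2)) ((hG σ).1 σ.2)
    obtain ⟨_, ⟨g, rfl⟩, hg⟩ := hσ
    exact ⟨g, Subtype.ext hg⟩
  have : IsSimpleGroup (Matrix.ProjectiveSpecialLinearGroup (Fin 2) (ZMod 11)) :=
    Matrix.ProjectiveSpecialLinearGroup.rank_two_simple (by simp)
  have hinj : Function.Injective ψ := by
    rw [← MonoidHom.ker_eq_bot_iff]
    refine ((MonoidHom.normal_ker ψ).eq_bot_or_eq_top).resolve_right fun h => ?_
    obtain ⟨x, hx⟩ := hsurj ⟨_, hs⟩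
    have hx1 : ψ x = 1 := MonoidHom.mem_ker.1 (h ▸ Subgroup.mem_top x)
    have : inversionPerm = 1 := congrArg Subtype.val (hx.symm.trans hx1)
    exact absurd this (by decide +kernel)
  exact ⟨(MulEquiv.ofBijective ψ ⟨hinj, hsurj⟩).symm⟩
end

section
/- The curve class C_𝒫 is well defined, i.e., its pairing values respect Keel's relations in Pic(Mbar_{0,12}): for every pair of distinct elements i, j ∈ X = Option (ZMod 11), the sum of c(T) over all subsets T ⊆ X with ∅ ≠ T ≠ X, i ∈ T and j ∉ T equals 0. -/
open Finset

/-- The 12-element index type of marked points of `Mbar_{0,12}`;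
`none` is the 12th marked point. -/
abbrev X : Type := Option (ZMod 11)

/-- For `B ⊆ ZMod 11`, the subset `B* = {some b : b ∈ B}` of `X`. -/
def bstar (B : Finset (ZMod 11)) : Finset X := B.image some

open Classical in
/-- The pairing of the curve class `C_𝒫` with the divisor generator `Δ_T`. -/
noncomputable def cP : Finset X → ℤ := fun T =>
  if ∃ B ∈ biplane, T = bstar B ∨ T = (bstar B)ᶜ then 1
  else if ∃ k : ZMod 11, T = {some k} ∨ T = ({some k} : Finset X)ᶜ then -3
  else if T = {none} ∨ T = ({none} : Finset X)ᶜ then -2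
  else 0

/-- The subsets `B*` and their complements, for `B` a block of the biplane. -/
def blockSets : Finset (Finset X) :=
  biplane.image bstar ∪ biplane.image fun B => (bstar B)ᶜ

/-- The singletons `{some k}` and their complements. -/
def pointSets : Finset (Finset X) :=
  (univ.image fun k : ZMod 11 => {some k}) ∪ univ.image fun k : ZMod 11 => ({some k} : Finset X)ᶜ

/-- The singleton `{none}` and its complement. -/
def noneSets : Finset (Finset X) := {{none}, {none}ᶜ}

theorem cP_eq (T : Finset X) :
    cP T = (if T ∈ blockSets then 1 else 0) + (if T ∈ pointSets then -3 else 0)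
      + (if T ∈ noneSets then -2 else 0) := by
  have hbp : Disjoint blockSets pointSets := by decide +kernel
  have hbn : Disjoint blockSets noneSets := by decide +kernel
  have hpn : Disjoint pointSets noneSets := by decide +kernel
  have hb : (∃ B ∈ biplane, T = bstar B ∨ T = (bstar B)ᶜ) ↔ T ∈ blockSets := by
    simp only [blockSets, mem_union, mem_image, and_or_left, exists_or, eq_comm]
  have hp : (∃ k : ZMod 11, T = {some k} ∨ T = ({some k} : Finset X)ᶜ) ↔ T ∈ pointSets := by
    simp only [pointSets, mem_union, mem_image, mem_univ, true_and, exists_or, eq_comm]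
  have hn : (T = {none} ∨ T = ({none} : Finset X)ᶜ) ↔ T ∈ noneSets := by
    simp only [noneSets, mem_insert, mem_singleton]
  simp only [cP, hb, hp, hn]
  by_cases h₁ : T ∈ blockSets
  · simp [h₁, disjoint_left.1 hbp h₁, disjoint_left.1 hbn h₁]
  · by_cases h₂ : T ∈ pointSets
    · simp [h₁, h₂, disjoint_left.1 hpn h₂]
    · simp [h₁, h₂]

theorem card_separating_sets : ∀ i j : X, i ≠ j →
    (#{T ∈ blockSets | i ∈ T ∧ j ∉ T} : ℤ) = 3 * #{T ∈ pointSets | i ∈ T ∧ j ∉ T}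
      + 2 * #{T ∈ noneSets | i ∈ T ∧ j ∉ T} := by
  decide +kernel

theorem sum_separating_ite (S : Finset (Finset X)) (a : ℤ) (i j : X) :
    ∑ T ∈ univ.filter (fun T : Finset X => T ≠ ∅ ∧ T ≠ univ ∧ i ∈ T ∧ j ∉ T),
      (if T ∈ S then a else 0) = a * #{T ∈ S | i ∈ T ∧ j ∉ T} := by
  rw [← sum_filter, sum_const, nsmul_eq_mul, mul_comm]
  congr 3
  ext T
  simp only [mem_filter, mem_univ, true_and]
  constructor
  · rintro ⟨⟨-, -, h⟩, hS⟩
    exact ⟨hS, h⟩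
  · rintro ⟨hS, hi, hj⟩
    refine ⟨⟨?_, ?_, hi, hj⟩, hS⟩
    · rintro rfl
      exact notMem_empty i hi
    · rintro rfl
      exact hj (mem_univ j)

/-- The curve class `C_𝒫` is well defined: its pairing values respect Keel's
relations, i.e. for every pair of distinct points `i j : X`, the sum of `c(T)` over all
`T` with `∅ ≠ T ≠ X`, `i ∈ T` and `j ∉ T` vanishes. -/
theorem curve_class_well_defined (i j : X) (hij : i ≠ j) :
    ∑ T ∈ Finset.univ.filter
        (fun T : Finset X => T ≠ ∅ ∧ T ≠ Finset.univ ∧ i ∈ T ∧ j ∉ T),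
      cP T = 0 := by
  simp only [cP_eq, sum_add_distrib, sum_separating_ite]
  linarith [card_separating_sets i j hij]
end

section
/- The intersection number D_𝒫 · C_𝒫 equals −1; concretely, the sum over all subsets T ⊆ X with ∅ ≠ T ≠ X of w(T)·c(T) equals −2 (each unordered boundary class {T, X∖T} is counted twice in this sum). In particular D_𝒫 pairs negatively with the effective-boundary-positive curve class C_𝒫, so D_𝒫 is not numerically equivalent to an effective sum of boundary divisors. -/
open Finset

open Classical in
/-- The Kapranov coefficient function of the divisor `D_𝒫`. -/
noncomputable def dP : Finset (ZMod 11) → ℤ := fun S =>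
  if S.card = 0 then -5
  else if S.card = 1 then -4
  else if S.card = 2 then -3
  else if S.card = 3 then -2
  else if S.card = 4 then -1
  else if (S.card = 5 ∨ S.card = 6) ∧ (S ∈ biplane ∨ ∃ B ∈ biplane, Disjoint S B)
    then -1
  else 0

/-- Extension of a Kapranov coefficient function on `Finset (ZMod 11)` to all boundary
classes, indexed by subsets `T ⊆ X`. -/
noncomputable def extendCoeff (e : Finset (ZMod 11) → ℤ) : Finset X → ℤ := fun T =>
  if none ∈ T then e (Finset.univ.filter fun a : ZMod 11 => some a ∈ T)
  else e (Finset.univ.filter fun a : ZMod 11 => some a ∉ T)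

theorem extendCoeff_compl (e : Finset (ZMod 11) → ℤ) (T : Finset X) :
    extendCoeff e Tᶜ = extendCoeff e T := by
  by_cases h : none ∈ T <;> simp [extendCoeff, h]

theorem extendCoeff_bstar (e : Finset (ZMod 11) → ℤ) (B : Finset (ZMod 11)) :
    extendCoeff e (bstar B) = e Bᶜ := by
  have h : (Finset.univ.filter fun a : ZMod 11 => some a ∉ bstar B) = Bᶜ := by
    ext a; simp [bstar]
  have hn : none ∉ bstar B := by simp [bstar]
  rw [extendCoeff, if_neg hn, h]

theorem extendCoeff_none (e : Finset (ZMod 11) → ℤ) :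
    extendCoeff e {none} = e ∅ := by
  simp [extendCoeff]

theorem bstar_singleton (k : ZMod 11) : bstar {k} = {some k} := by
  simp [bstar]

theorem bstar_injective : Function.Injective bstar :=
  Finset.image_injective (Option.some_injective _)

theorem card_biplane : biplane.card = 11 := by
  decide +kernel

theorem card_of_mem_biplane {B : Finset (ZMod 11)} (hB : B ∈ biplane) : B.card = 5 := by
  obtain ⟨t, -, rfl⟩ := Finset.mem_image.mp hB
  rw [Finset.card_image_of_injective _ (add_left_injective t)]
  rfl

theorem card_bstar (B : Finset (ZMod 11)) : (bstar B).card = B.card :=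
  Finset.card_image_of_injective _ (Option.some_injective _)

theorem card_compl_X (T : Finset X) : Tᶜ.card = 12 - T.card := by
  rw [Finset.card_compl]
  rfl

theorem card_compl_zmod (B : Finset (ZMod 11)) : Bᶜ.card = 11 - B.card := by
  rw [Finset.card_compl, ZMod.card]

theorem dP_empty : dP ∅ = -5 := by
  simp [dP]

theorem dP_compl_singleton (k : ZMod 11) : dP {k}ᶜ = 0 := by
  simp [dP, card_compl_zmod]

theorem dP_compl_block {B : Finset (ZMod 11)} (hB : B ∈ biplane) : dP Bᶜ = -1 := by
  have h : ∃ B' ∈ biplane, Disjoint Bᶜ B' := ⟨B, hB, disjoint_compl_left⟩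
  simp [dP, card_compl_zmod, card_of_mem_biplane hB, h]

/-- The subsets `B*` and `X ∖ B*` for blocks `B` of the biplane. -/
def blockClasses : Finset (Finset X) :=
  biplane.image bstar ∪ biplane.image fun B => (bstar B)ᶜ

theorem mem_blockClasses {T : Finset X} :
    T ∈ blockClasses ↔ ∃ B ∈ biplane, T = bstar B ∨ T = (bstar B)ᶜ := by
  simp only [blockClasses, mem_union, mem_image]
  grind

theorem card_of_mem_blockClasses {T : Finset X} (hT : T ∈ blockClasses) :
    T.card = 5 ∨ T.card = 7 := by
  obtain ⟨B, hB, rfl | rfl⟩ := mem_blockClasses.mp hT <;>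
    simp [card_compl_X, card_bstar, card_of_mem_biplane hB]

theorem card_blockClasses : blockClasses.card = 22 := by
  rw [blockClasses, card_union_of_disjoint, card_image_of_injective _ bstar_injective,
    card_image_of_injective (f := fun B => (bstar B)ᶜ) _
      (compl_injective.comp bstar_injective), card_biplane]
  rw [Finset.disjoint_left]
  intro T hT hT'
  obtain ⟨B, hB, rfl⟩ := mem_image.mp hT
  obtain ⟨B', hB', h⟩ := mem_image.mp hT'
  have := congrArg Finset.card h
  rw [card_compl_X, card_bstar, card_bstar, card_of_mem_biplane hB,
    card_of_mem_biplane hB'] at this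
  omega

/-- The two subsets representing the boundary class of the last marked point. -/
def noneClasses : Finset (Finset X) := {{none}, {none}ᶜ}

theorem card_of_mem_noneClasses {T : Finset X} (hT : T ∈ noneClasses) :
    T.card = 1 ∨ T.card = 11 := by
  simp only [noneClasses, mem_insert, mem_singleton] at hT
  obtain rfl | rfl := hT <;> simp [card_compl_X]

theorem card_noneClasses : noneClasses.card = 2 := by
  refine Finset.card_pair fun h => ?_
  have := congrArg Finset.card h
  simp [card_compl_X] at this

theorem disjoint_blockClasses_noneClasses : Disjoint blockClasses noneClasses := by
  rw [Finset.disjoint_left]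
  intro T h h'
  have := card_of_mem_blockClasses h
  have := card_of_mem_noneClasses h'
  omega

theorem extendCoeff_mul_cP_of_mem_blockClasses {T : Finset X} (hT : T ∈ blockClasses) :
    extendCoeff dP T * cP T = -1 := by
  have hc : cP T = 1 := if_pos (mem_blockClasses.mp hT)
  obtain ⟨B, hB, rfl | rfl⟩ := mem_blockClasses.mp hT <;>
    simp [hc, extendCoeff_compl, extendCoeff_bstar, dP_compl_block hB]

theorem extendCoeff_mul_cP_of_mem_noneClasses {T : Finset X} (hT : T ∈ noneClasses) :
    extendCoeff dP T * cP T = 10 := by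
  have hb : T ∉ blockClasses := Finset.disjoint_right.mp disjoint_blockClasses_noneClasses hT
  have hT' : T = {none} ∨ T = ({none} : Finset X)ᶜ := by simpa [noneClasses] using hT
  have hk : ¬ ∃ k : ZMod 11, T = {some k} ∨ T = ({some k} : Finset X)ᶜ := by
    rintro ⟨k, h⟩
    obtain rfl | rfl := hT' <;> obtain h | h := h
    · simp at h
    · simpa [card_compl_X] using congrArg Finset.card h
    · simpa [card_compl_X] using congrArg Finset.card h
    · simp at h
  have hc : cP T = -2 := by
    rw [cP, if_neg (mem_blockClasses.not.mp hb), if_neg hk, if_pos hT']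
  obtain rfl | rfl := hT' <;>
    simp [hc, extendCoeff_compl, extendCoeff_none, dP_empty]

theorem extendCoeff_mul_cP_of_notMem {T : Finset X} (hT : T ∉ blockClasses ∪ noneClasses) :
    extendCoeff dP T * cP T = 0 := by
  rw [mem_union, not_or] at hT
  obtain ⟨hb, hn⟩ := hT
  by_cases hk : ∃ k : ZMod 11, T = {some k} ∨ T = ({some k} : Finset X)ᶜ
  · obtain ⟨k, rfl | rfl⟩ := hk <;>
      simp [extendCoeff_compl, ← bstar_singleton, extendCoeff_bstar, dP_compl_singleton]
  · have hn' : ¬ (T = {none} ∨ T = ({none} : Finset X)ᶜ) := by simpa [noneClasses] using hn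
    rw [cP, if_neg (mem_blockClasses.not.mp hb), if_neg hk, if_neg hn', mul_zero]

/-- `D_𝒫 · C_𝒫 = −1`: the sum of `w(T)·c(T)` over all `T` with `∅ ≠ T ≠ X` equals `−2`
(each unordered boundary class is counted twice), so `D_𝒫` pairs negatively with `C_𝒫`. -/
theorem DP_dot_CP :
    ∑ T ∈ Finset.univ.filter (fun T : Finset X => T ≠ ∅ ∧ T ≠ Finset.univ),
      extendCoeff dP T * cP T = -2 := by
  have hsub : blockClasses ∪ noneClasses ⊆
      Finset.univ.filter (fun T : Finset X => T ≠ ∅ ∧ T ≠ Finset.univ) := by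
    intro T hT
    have hcard : T.card ≠ 0 ∧ T.card ≠ 12 := by
      rcases mem_union.mp hT with h | h
      · have := card_of_mem_blockClasses h
        omega
      · have := card_of_mem_noneClasses h
        omega
    rw [mem_filter]
    refine ⟨mem_univ _, ?_, ?_⟩ <;> rintro rfl
    · exact hcard.1 rfl
    · exact hcard.2 rfl
  rw [← sum_subset hsub fun T _ hT => extendCoeff_mul_cP_of_notMem hT,
    sum_union disjoint_blockClasses_noneClasses,
    sum_congr rfl fun T hT => extendCoeff_mul_cP_of_mem_blockClasses hT,
    sum_congr rfl fun T hT => extendCoeff_mul_cP_of_mem_noneClasses hT,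
    sum_const, sum_const, card_blockClasses, card_noneClasses]
  norm_num
end

section
/- Let n ≥ 3 and let ℓ := Fin.last n ∈ Fin (n+1). Let a : Finset (Fin (n+1)) → ℝ satisfy: (i) a(T) ≥ 0 for all T; (ii) a(T) = a(Tᶜ) for all T; (iii) a(T) = 0 whenever |T| ≤ 1 or |T| ≥ n. Define f(S) := a(S ∪ {ℓ}) − a(S) for S ⊆ Fin (n+1) ∖ {ℓ}. Suppose that for every partition of Fin (n+1) ∖ {ℓ} into three nonempty pairwise disjoint sets A, B, C one has f(A ∪ B) = f(A) + f(B). Then f(S) = 0, i.e., a(S ∪ {ℓ}) = a(S), for every nonempty proper subset S of Fin (n+1) ∖ {ℓ}. (This is the combinatorial heart of the lemma that an F-nef pullback divisor expressed as an effective boundary sum must be a pullback of an effective boundary sum.) -/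
open Finset

/-- The combinatorial heart of Lemma `pullback`: if the coefficients `a` of an effective
boundary expression of a pullback divisor vanish on F-curves contracted by the forgetful
map (encoded by the additivity of `f(S) = a(S ∪ {ℓ}) − a(S)` on partitions of the
complement of `ℓ = Fin.last n` into three nonempty parts), then `a(S ∪ {ℓ}) = a(S)` for
every nonempty proper subset `S` of the complement of `ℓ`. -/
theorem pullback_coeff_eq (n : ℕ) (hn : 3 ≤ n) (a : Finset (Fin (n + 1)) → ℝ)
    (ha_nonneg : ∀ T, 0 ≤ a T)
    (ha_compl : ∀ T, a T = a Tᶜ)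
    (ha_vanish : ∀ T : Finset (Fin (n + 1)), T.card ≤ 1 ∨ n ≤ T.card → a T = 0)
    (hadd : ∀ A B C : Finset (Fin (n + 1)),
      A.Nonempty → B.Nonempty → C.Nonempty →
      Disjoint A B → Disjoint A C → Disjoint B C →
      A ∪ B ∪ C = ({Fin.last n} : Finset (Fin (n + 1)))ᶜ →
      a ((A ∪ B) ∪ {Fin.last n}) - a (A ∪ B) =
        (a (A ∪ {Fin.last n}) - a A) + (a (B ∪ {Fin.last n}) - a B)) :
    ∀ S : Finset (Fin (n + 1)), S.Nonempty →
      S ⊆ ({Fin.last n} : Finset (Fin (n + 1)))ᶜ →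
      S ≠ ({Fin.last n} : Finset (Fin (n + 1)))ᶜ →
      a (S ∪ {Fin.last n}) = a S := by
  have nonneg : ∀ S : Finset (Fin (n + 1)), S.Nonempty →
      S ⊆ ({Fin.last n} : Finset (Fin (n + 1)))ᶜ →
      S ≠ ({Fin.last n} : Finset (Fin (n + 1)))ᶜ →
      0 ≤ a (S ∪ {Fin.last n}) - a S := by
    have singleton_nonneg : ∀ i, 0 ≤ a ({i} ∪ {Fin.last n}) - a {i} := fun i => by
      rw [ha_vanish {i} (Or.inl (card_singleton i).le), sub_zero]
      exact ha_nonneg _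
    intro S hS
    induction hS using Finset.Nonempty.cons_induction with
    | singleton i => exact fun _ _ => singleton_nonneg i
    | cons i s hi hs ih =>
      intro hsub hne
      rw [cons_eq_insert] at hsub hne ⊢
      have hs_sub := (subset_insert i s).trans hsub
      have hs_ne : s ≠ ({Fin.last n} : Finset (Fin (n + 1)))ᶜ := by
        rintro rfl
        exact hi (hsub (mem_insert_self _ _))
      have h := hadd {i} s (({Fin.last n} : Finset (Fin (n + 1)))ᶜ \ insert i s)
        (singleton_nonempty i) hs
        (sdiff_nonempty.mpr fun hle => hne (hsub.antisymm hle))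
        (disjoint_singleton_left.mpr hi)
        (disjoint_sdiff.mono_left (singleton_subset_iff.mpr (mem_insert_self i s)))
        (disjoint_sdiff.mono_left (subset_insert i s))
        (by rw [← insert_eq]; exact union_sdiff_of_subset hsub)
      rw [← insert_eq] at h
      rw [h]
      exact add_nonneg (singleton_nonneg i) (ih hs_sub hs_ne)
  intro S hS hsub hne
  have hS_nonneg := nonneg S hS hsub hne
  have hT_nonneg := nonneg (({Fin.last n} : Finset (Fin (n + 1)))ᶜ \ S)
    (sdiff_nonempty.mpr fun hle => hne (hsub.antisymm hle)) sdiff_subset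
    (fun h => by
      obtain ⟨x, hx⟩ := hS
      exact (mem_sdiff.mp (h.symm ▸ hsub hx)).2 hx)
  have hT : (S ∪ {Fin.last n})ᶜ = ({Fin.last n} : Finset (Fin (n + 1)))ᶜ \ S := by
    ext x
    simp only [mem_compl, mem_union, mem_sdiff]
    tauto
  have hT_compl : (({Fin.last n} : Finset (Fin (n + 1)))ᶜ \ S ∪ {Fin.last n})ᶜ = S := by
    ext x
    have := @hsub x
    simp only [mem_compl, mem_union, mem_sdiff] at this ⊢
    tauto
  rw [ha_compl (_ \ S ∪ _), hT_compl, ← hT, ← ha_compl] at hT_nonneg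
  linarith
end

section
/- Let n ≥ 3 and let f be a real-valued function on the nonempty proper subsets of Fin n such that: (i) f(A ∪ B) = f(A) + f(B) whenever A and B are disjoint nonempty subsets with A ∪ B a proper subset of Fin n; (ii) f(Sᶜ) = −f(S) for every nonempty proper subset S; and (iii) f({k}) ≥ 0 for every k ∈ Fin n. Then f(S) = 0 for every nonempty proper subset S of Fin n. -/
open Finset

/-- A set function additive on disjoint nonempty sets with proper union is nonnegative on
nonempty proper subsets as soon as it is nonnegative on singletons. -/
theorem nonneg_of_additive_of_singleton_nonneg {α : Type*} [Fintype α] [DecidableEq α]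
    {f : Finset α → ℝ}
    (hadd : ∀ A B : Finset α, A.Nonempty → B.Nonempty → Disjoint A B →
      A ∪ B ≠ Finset.univ → f (A ∪ B) = f A + f B)
    (hsingle : ∀ k : α, 0 ≤ f {k}) {S : Finset α} (hS : S.Nonempty) (hS' : S ≠ Finset.univ) :
    0 ≤ f S := by
  induction hS using Finset.Nonempty.cons_induction with
  | singleton a => exact hsingle a
  | cons a s ha hs ih =>
    rw [Finset.cons_eq_insert, Finset.insert_eq] at hS' ⊢
    have hs' : s ≠ Finset.univ := fun h => ha (h ▸ Finset.mem_univ a)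
    rw [hadd {a} s (Finset.singleton_nonempty a) hs (Finset.disjoint_singleton_left.mpr ha) hS']
    exact add_nonneg (hsingle a) (ih hs')

/-- The additive-set-function lemma behind Lemma `pullback`: a function `f` on the
nonempty proper subsets of `Fin n` that is additive on disjoint unions, sends
complements to negatives, and is nonnegative on singletons, vanishes identically. -/
theorem additive_set_function_zero (n : ℕ) (hn : 3 ≤ n) (f : Finset (Fin n) → ℝ)
    (hadd : ∀ A B : Finset (Fin n), A.Nonempty → B.Nonempty → Disjoint A B →
      A ∪ B ≠ Finset.univ → f (A ∪ B) = f A + f B)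
    (hcompl : ∀ S : Finset (Fin n), S.Nonempty → S ≠ Finset.univ → f Sᶜ = -f S)
    (hsingle : ∀ k : Fin n, 0 ≤ f {k}) :
    ∀ S : Finset (Fin n), S.Nonempty → S ≠ Finset.univ → f S = 0 := by
  intro S hS hS'
  have h := nonneg_of_additive_of_singleton_nonneg hadd hsingle hS hS'
  have hc : 0 ≤ f Sᶜ := nonneg_of_additive_of_singleton_nonneg hadd hsingle
    (Finset.nonempty_iff_ne_empty.mpr (by simpa using hS'))
    (by simpa using hS.ne_empty)
  linarith [hcompl S hS hS']
end
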